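/- Suppose Ψ(λ₀) > 0 for the fixed λ₀ > 0. Then for any l ≥ 1 there is a constant λ₁ > 0 (one may take λ₁ = λ₀⁻¹ e^{−λ₀ l} Ψ(λ₀)) such that for all (x,y) ∈ Δᶜ: L̃F₀(x,y) ≤ −cλ₀²θ y e^{−λ₀(x−y)} − θ y μ_{x−y}((0,∞)) − θ ν_{x−y}((0,∞)) − λ₁θ ψ(x−y) 1_{x−y≤l} + [y μ_{x−y}((0,∞)) + I(x) + J(x)]·[1+ψ(x−y)]·1_{x≤x₀} + [1+ψ(x−y)]·(∫₀^∞[φ(x+z) − φ(x)](ν − ν_{y−x})(dz))·1_{x≤x₀}, where I(x) = [β − bx − g(x)]φ′(x) and J(x) = (3x/x₀²)(2c + ∫₀^1 z² μ(dz)). -/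

import Mathlib

open MeasureTheory

/-- For a σ-finite Borel measure `m` on `ℝ` vanishing on `(-∞,0]` and `x ∈ ℝ`,
`mShift m x = ½ (m ∧ T_x m)` where `T_x m` is the image of `m` under `z ↦ z + x`
and `∧` is the infimum in the lattice of measures. -/
noncomputable def mShift (m : Measure ℝ) (x : ℝ) : Measure ℝ :=
  (2⁻¹ : ENNReal) • (m ⊓ Measure.map (fun z => z + x) m)

/-- First partial derivative of `F` in the first variable. -/
noncomputable def Fx (F : ℝ → ℝ → ℝ) (x y : ℝ) : ℝ := deriv (fun t => F t y) x

/-- First partial derivative of `F` in the second variable. -/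
noncomputable def Fy (F : ℝ → ℝ → ℝ) (x y : ℝ) : ℝ := deriv (fun t => F x t) y

/-- Second partial derivative `F″_{xx}`. -/
noncomputable def Fxx (F : ℝ → ℝ → ℝ) (x y : ℝ) : ℝ := deriv (fun t => Fx F t y) x

/-- Second partial derivative `F″_{yy}`. -/
noncomputable def Fyy (F : ℝ → ℝ → ℝ) (x y : ℝ) : ℝ := deriv (fun t => Fy F x t) y

/-- Mixed second partial derivative `F″_{xy}`. -/
noncomputable def Fxy (F : ℝ → ℝ → ℝ) (x y : ℝ) : ℝ := deriv (fun t => Fx F x t) y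

/-- `cutoff z = z 1_{z ≤ 1}`. -/
noncomputable def cutoff (z : ℝ) : ℝ := if z ≤ 1 then z else 0

/-- The part `L̃₀` of the coupling generator. -/
noncomputable def Ltil0 (b c β : ℝ) (g : ℝ → ℝ) (μ ν : Measure ℝ)
    (F : ℝ → ℝ → ℝ) (x y : ℝ) : ℝ :=
  (β - b * x - g x) * Fx F x y + (β - b * y - g y) * Fy F x y
    + c * x * Fxx F x y + c * y * Fyy F x y - 2 * c * y * Fxy F x y
    + (∫ z in Set.Ioi (0 : ℝ), (F (x + z) (y + z) - F x y) ∂ν)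
    + (x - y) * (∫ z in Set.Ioi (0 : ℝ), (F (x + z) y - F x y - Fx F x y * cutoff z) ∂μ)
    + y * (∫ z in Set.Ioi (0 : ℝ),
        (F (x + z) (y + z) - F x y - (Fx F x y + Fy F x y) * cutoff z) ∂μ)

/-- The part `L̃₁` of the coupling generator (induced by the lassoing process). -/
noncomputable def Ltil1 (μ ν : Measure ℝ) (F : ℝ → ℝ → ℝ) (x y : ℝ) : ℝ :=
  y * (∫ z in Set.Ioi (0 : ℝ), (F (x + z) (2 * y + z - x) - F (x + z) (y + z)) ∂(mShift μ (x - y)))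
    + y * (∫ z in Set.Ioi (0 : ℝ), (F (x + z) (x + z) - F (x + z) (y + z)) ∂(mShift μ (y - x)))
    + (∫ z in Set.Ioi (0 : ℝ), (F (x + z) (2 * y + z - x) - F (x + z) (y + z)) ∂(mShift ν (x - y)))
    + (∫ z in Set.Ioi (0 : ℝ), (F (x + z) (x + z) - F (x + z) (y + z)) ∂(mShift ν (y - x)))

/-- The coupling generator `L̃ = L̃₀ + L̃₁`. -/
noncomputable def Ltil (b c β : ℝ) (g : ℝ → ℝ) (μ ν : Measure ℝ)
    (F : ℝ → ℝ → ℝ) (x y : ℝ) : ℝ :=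
  Ltil0 b c β g μ ν F x y + Ltil1 μ ν F x y

/-- `Δᶜ = D ∖ Δ = {(x,y) : 0 ≤ y < x}`. -/
def DeltaC : Set (ℝ × ℝ) := {p | 0 ≤ p.2 ∧ p.2 < p.1}

/-- `F` belongs to the domain of the coupling generator `L̃`: all the integrals
appearing in `L̃₀F` and `L̃₁F` converge at each point of `Δᶜ`, and `L̃F` is
bounded on compact subsets of `Δᶜ`. -/
def InDomLtil (b c β : ℝ) (g : ℝ → ℝ) (μ ν : Measure ℝ) (F : ℝ → ℝ → ℝ) : Prop :=
  (∀ x y : ℝ, 0 ≤ y → y < x →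
    MeasureTheory.IntegrableOn (fun z => F (x + z) (y + z) - F x y) (Set.Ioi 0) ν ∧
    MeasureTheory.IntegrableOn (fun z => F (x + z) y - F x y - Fx F x y * cutoff z)
      (Set.Ioi 0) μ ∧
    MeasureTheory.IntegrableOn
      (fun z => F (x + z) (y + z) - F x y - (Fx F x y + Fy F x y) * cutoff z) (Set.Ioi 0) μ ∧
    MeasureTheory.IntegrableOn (fun z => F (x + z) (2 * y + z - x) - F (x + z) (y + z))
      (Set.Ioi 0) (mShift μ (x - y)) ∧
    MeasureTheory.IntegrableOn (fun z => F (x + z) (x + z) - F (x + z) (y + z))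
      (Set.Ioi 0) (mShift μ (y - x)) ∧
    MeasureTheory.IntegrableOn (fun z => F (x + z) (2 * y + z - x) - F (x + z) (y + z))
      (Set.Ioi 0) (mShift ν (x - y)) ∧
    MeasureTheory.IntegrableOn (fun z => F (x + z) (x + z) - F (x + z) (y + z))
      (Set.Ioi 0) (mShift ν (y - x))) ∧
  (∀ K : Set (ℝ × ℝ), K ⊆ DeltaC → IsCompact K →
    ∃ M : ℝ, ∀ p ∈ K, |Ltil b c β g μ ν F p.1 p.2| ≤ M)

/-- The branching mechanism `Ψ(λ) = bλ + cλ² + ∫₀^∞(e^{−λz} − 1 + λz 1_{z≤1}) μ(dz)`. -/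
noncomputable def Psi (b c : ℝ) (μ : Measure ℝ) (l : ℝ) : ℝ :=
  b * l + c * l ^ 2
    + ∫ z in Set.Ioi (0 : ℝ), (Real.exp (-(l * z)) - 1 + l * cutoff z) ∂μ

/-- `ψ(x) = 1 − e^{−λ₀ x}`. -/
noncomputable def psi0 (lam0 x : ℝ) : ℝ := 1 - Real.exp (-(lam0 * x))

/-- `φ(x) = θ + (1 − x/x₀)³` for `0 ≤ x < x₀`, and `φ(x) = θ` for `x ≥ x₀`. -/
noncomputable def phi0 (x0 θ x : ℝ) : ℝ := if x < x0 then θ + (1 - x / x0) ^ 3 else θ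

/-- `F₀(x,y) = φ(x)[1 + ψ(x−y)] 1_{x≠y}`. -/
noncomputable def F0 (lam0 x0 θ : ℝ) (x y : ℝ) : ℝ :=
  if x = y then 0 else phi0 x0 θ x * (1 + psi0 lam0 (x - y))

lemma hasDerivAt_max_zero_pow (n : ℕ) (w : ℝ) :
    HasDerivAt (fun t : ℝ => max t 0 ^ (n + 2)) ((n + 2 : ℕ) * max w 0 ^ (n + 1)) w := by
  rcases lt_trichotomy w 0 with hw | rfl | hw
  · have h : (fun t : ℝ => max t 0 ^ (n + 2)) =ᶠ[nhds w] fun _ => 0 := by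
      filter_upwards [Iio_mem_nhds hw] with t ht
      simp [max_eq_right (Set.mem_Iio.mp ht).le]
    simpa [max_eq_right hw.le] using (hasDerivAt_const w (0 : ℝ)).congr_of_eventuallyEq h
  · have h : (fun t : ℝ => max t 0 ^ (n + 2)) =O[nhds 0] fun t => ‖t - 0‖ ^ (n + 2) := by
      refine Asymptotics.IsBigO.of_bound 1 (Filter.Eventually.of_forall fun t => ?_)
      rw [one_mul, sub_zero, norm_pow, norm_pow, norm_norm]
      refine pow_le_pow_left₀ (norm_nonneg _) ?_ _
      rw [Real.norm_eq_abs, Real.norm_eq_abs, abs_of_nonneg (le_max_right t 0)]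
      exact max_le (le_abs_self t) (abs_nonneg t)
    have := (h.hasFDerivAt (by omega)).hasDerivAt
    simpa using this
  · have h : (fun t : ℝ => max t 0 ^ (n + 2)) =ᶠ[nhds w] fun t => t ^ (n + 2) := by
      filter_upwards [Ioi_mem_nhds hw] with t ht
      rw [max_eq_left (Set.mem_Ioi.mp ht).le]
    simpa [max_eq_left hw.le] using (hasDerivAt_pow (n + 2) w).congr_of_eventuallyEq h

lemma phi0_eq {x0 : ℝ} (hx0 : 0 < x0) (θ x : ℝ) :
    phi0 x0 θ x = θ + max (1 - x / x0) 0 ^ 3 := by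
  unfold phi0
  split_ifs with h
  · rw [max_eq_left]
    rw [sub_nonneg, div_le_one hx0]
    exact h.le
  · rw [max_eq_right]
    · simp
    · rw [sub_nonpos, one_le_div hx0]
      exact not_lt.mp h

lemma hasDerivAt_phi0 {x0 : ℝ} (hx0 : 0 < x0) (θ x : ℝ) :
    HasDerivAt (phi0 x0 θ) (-(3 / x0) * max (1 - x / x0) 0 ^ 2) x := by
  have h1 : HasDerivAt (fun t : ℝ => 1 - t / x0) (-(1 / x0)) x :=
    ((hasDerivAt_id x).div_const x0).const_sub 1
  have h2 := ((hasDerivAt_max_zero_pow 1 (1 - x / x0)).comp x h1).const_add θ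
  have h3 : phi0 x0 θ = fun t => θ + ((fun t : ℝ => max t 0 ^ (1 + 2)) ∘ fun t => 1 - t / x0) t := by
    funext t
    exact phi0_eq hx0 θ t
  rw [h3]
  refine h2.congr_deriv ?_
  push_cast
  ring

lemma hasDerivAt_deriv_phi0 {x0 : ℝ} (hx0 : 0 < x0) (θ x : ℝ) :
    HasDerivAt (deriv (phi0 x0 θ)) (6 / x0 ^ 2 * max (1 - x / x0) 0) x := by
  have h1 : HasDerivAt (fun t : ℝ => 1 - t / x0) (-(1 / x0)) x :=
    ((hasDerivAt_id x).div_const x0).const_sub 1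
  have h2 := ((hasDerivAt_max_zero_pow 0 (1 - x / x0)).comp x h1).const_mul (-(3 / x0))
  have h3 : deriv (phi0 x0 θ) =
      fun t => -(3 / x0) * ((fun t : ℝ => max t 0 ^ (0 + 2)) ∘ fun t => 1 - t / x0) t := by
    funext t
    exact (hasDerivAt_phi0 hx0 θ t).deriv
  rw [h3]
  refine h2.congr_deriv ?_
  push_cast
  field_simp
  ring

lemma F0_of_ne (lam0 x0 θ : ℝ) {x y : ℝ} (h : x ≠ y) :
    F0 lam0 x0 θ x y = phi0 x0 θ x * (1 + psi0 lam0 (x - y)) := if_neg h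

lemma hasDerivAt_exp_neg_mul_sub_left (lam0 x y : ℝ) :
    HasDerivAt (fun t => Real.exp (-(lam0 * (t - y))))
      (-(lam0 * Real.exp (-(lam0 * (x - y))))) x := by
  have h : HasDerivAt (fun t => -(lam0 * (t - y))) (-(lam0 * 1)) x :=
    (((hasDerivAt_id x).sub_const y).const_mul lam0).neg
  convert h.exp using 1
  ring

lemma hasDerivAt_exp_neg_mul_sub_right (lam0 x y : ℝ) :
    HasDerivAt (fun t => Real.exp (-(lam0 * (x - t))))
      (lam0 * Real.exp (-(lam0 * (x - y)))) y := by
  have h : HasDerivAt (fun t => -(lam0 * (x - t))) (-(lam0 * -1)) y :=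
    (((hasDerivAt_id y).const_sub x).const_mul lam0).neg
  convert h.exp using 1
  ring

lemma Fx_F0 (lam0 θ : ℝ) {x0 x y : ℝ} (hx0 : 0 < x0) (h : x ≠ y) :
    Fx (F0 lam0 x0 θ) x y = deriv (phi0 x0 θ) x * (2 - Real.exp (-(lam0 * (x - y))))
      + phi0 x0 θ x * (lam0 * Real.exp (-(lam0 * (x - y)))) := by
  have he : (fun t => F0 lam0 x0 θ t y) =ᶠ[nhds x]
      fun t => phi0 x0 θ t * (2 - Real.exp (-(lam0 * (t - y)))) := by
    filter_upwards [isOpen_ne.mem_nhds h] with t ht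
    rw [F0_of_ne _ _ _ ht, psi0]
    ring
  have h1 := (hasDerivAt_phi0 hx0 θ x).mul ((hasDerivAt_exp_neg_mul_sub_left lam0 x y).const_sub 2)
  rw [Fx, (h1.congr_of_eventuallyEq he).deriv, (hasDerivAt_phi0 hx0 θ x).deriv]
  ring

lemma Fy_F0 (lam0 θ : ℝ) {x0 x y : ℝ} (h : x ≠ y) :
    Fy (F0 lam0 x0 θ) x y = -(phi0 x0 θ x * (lam0 * Real.exp (-(lam0 * (x - y))))) := by
  have he : (fun t => F0 lam0 x0 θ x t) =ᶠ[nhds y]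
      fun t => phi0 x0 θ x * (2 - Real.exp (-(lam0 * (x - t)))) := by
    filter_upwards [isOpen_ne.mem_nhds h.symm] with t ht
    rw [F0_of_ne _ _ _ (Ne.symm ht), psi0]
    ring
  have h1 := ((hasDerivAt_exp_neg_mul_sub_right lam0 x y).const_sub 2).const_mul (phi0 x0 θ x)
  rw [Fy, (h1.congr_of_eventuallyEq he).deriv]
  ring

lemma Fxx_F0 (lam0 θ : ℝ) {x0 x y : ℝ} (hx0 : 0 < x0) (h : x ≠ y) :
    Fxx (F0 lam0 x0 θ) x y =
      6 / x0 ^ 2 * max (1 - x / x0) 0 * (2 - Real.exp (-(lam0 * (x - y))))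
        + 2 * (deriv (phi0 x0 θ) x * (lam0 * Real.exp (-(lam0 * (x - y)))))
        - phi0 x0 θ x * (lam0 ^ 2 * Real.exp (-(lam0 * (x - y)))) := by
  have he : (fun t => Fx (F0 lam0 x0 θ) t y) =ᶠ[nhds x]
      fun t => deriv (phi0 x0 θ) t * (2 - Real.exp (-(lam0 * (t - y))))
        + phi0 x0 θ t * (lam0 * Real.exp (-(lam0 * (t - y)))) := by
    filter_upwards [isOpen_ne.mem_nhds h] with t ht
    exact Fx_F0 lam0 θ hx0 ht
  have h0 := hasDerivAt_exp_neg_mul_sub_left lam0 x y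
  have h1 := ((hasDerivAt_deriv_phi0 hx0 θ x).mul (h0.const_sub 2)).add
    ((hasDerivAt_phi0 hx0 θ x).mul (h0.const_mul lam0))
  rw [Fxx, (h1.congr_of_eventuallyEq he).deriv, (hasDerivAt_phi0 hx0 θ x).deriv]
  ring

lemma Fyy_F0 (lam0 θ : ℝ) {x0 x y : ℝ} (h : x ≠ y) :
    Fyy (F0 lam0 x0 θ) x y = -(phi0 x0 θ x * (lam0 ^ 2 * Real.exp (-(lam0 * (x - y))))) := by
  have he : (fun t => Fy (F0 lam0 x0 θ) x t) =ᶠ[nhds y]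
      fun t => -(phi0 x0 θ x * (lam0 * Real.exp (-(lam0 * (x - t))))) := by
    filter_upwards [isOpen_ne.mem_nhds h.symm] with t ht
    exact Fy_F0 lam0 θ (Ne.symm ht)
  have h1 := (((hasDerivAt_exp_neg_mul_sub_right lam0 x y).const_mul lam0).const_mul
    (phi0 x0 θ x)).neg
  rw [Fyy, (HasDerivAt.congr_of_eventuallyEq h1 he).deriv]
  ring

lemma Fxy_F0 (lam0 θ : ℝ) {x0 x y : ℝ} (hx0 : 0 < x0) (h : x ≠ y) :
    Fxy (F0 lam0 x0 θ) x y = -(deriv (phi0 x0 θ) x * (lam0 * Real.exp (-(lam0 * (x - y)))))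
      + phi0 x0 θ x * (lam0 ^ 2 * Real.exp (-(lam0 * (x - y)))) := by
  have he : (fun t => Fx (F0 lam0 x0 θ) x t) =ᶠ[nhds y]
      fun t => deriv (phi0 x0 θ) x * (2 - Real.exp (-(lam0 * (x - t))))
        + phi0 x0 θ x * (lam0 * Real.exp (-(lam0 * (x - t)))) := by
    filter_upwards [isOpen_ne.mem_nhds h.symm] with t ht
    exact Fx_F0 lam0 θ hx0 (Ne.symm ht)
  have h0 := hasDerivAt_exp_neg_mul_sub_right lam0 x y
  have h1 := ((h0.const_sub 2).const_mul (deriv (phi0 x0 θ) x)).add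
    ((h0.const_mul lam0).const_mul (phi0 x0 θ x))
  rw [Fxy, (h1.congr_of_eventuallyEq he).deriv]
  ring

lemma map_inf_measurableEquiv {α γ : Type*} [MeasurableSpace α] [MeasurableSpace γ]
    (e : α ≃ᵐ γ) (m₁ m₂ : Measure α) :
    (m₁ ⊓ m₂).map e = m₁.map e ⊓ m₂.map e := by
  refine le_antisymm (le_inf (Measure.map_mono inf_le_left e.measurable)
    (Measure.map_mono inf_le_right e.measurable)) ?_
  have h : (m₁.map e ⊓ m₂.map e).map e.symm ≤ m₁ ⊓ m₂ := by
    refine le_inf ?_ ?_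
    · simpa using Measure.map_mono (μ := m₁.map e ⊓ m₂.map e) inf_le_left e.symm.measurable
    · simpa using Measure.map_mono (μ := m₁.map e ⊓ m₂.map e) inf_le_right e.symm.measurable
  simpa using Measure.map_mono h e.measurable

lemma map_mShift (m : Measure ℝ) (r : ℝ) :
    (mShift m r).map (fun z => z + -r) = mShift m (-r) := by
  have h := map_inf_measurableEquiv (MeasurableEquiv.addRight (-r)) m (m.map fun z => z + r)
  rw [MeasurableEquiv.coe_addRight, Measure.map_map (by fun_prop) (by fun_prop)] at h
  have hid : ((fun z => z + -r) ∘ fun z : ℝ => z + r) = id := by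
    funext z
    simp
  rw [hid, Measure.map_id, inf_comm] at h
  rw [mShift, Measure.map_smul, inf_comm, h, mShift, inf_comm]

lemma mShift_le (m : Measure ℝ) (r : ℝ) : mShift m r ≤ m := by
  intro s
  rw [mShift, Measure.smul_apply, smul_eq_mul]
  calc (2⁻¹ : ENNReal) * (m ⊓ m.map fun z => z + r) s ≤ 1 * m s := by
        gcongr
        · simp
        · exact inf_le_left
    _ = m s := one_mul _

lemma mShift_apply_Ioi_zero {m : Measure ℝ} (hm : m (Set.Iic 0) = 0) (r : ℝ) :
    mShift m r (Set.Ioi 0) = mShift m r Set.univ := by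
  have h : mShift m r (Set.Iic 0) = 0 := le_antisymm (hm ▸ mShift_le m r _) zero_le
  rw [← Set.compl_Iic]
  exact measure_congr (by
    rw [ae_eq_univ, compl_compl]
    exact h)

lemma mShift_neg_apply_Ioi_zero {m : Measure ℝ} (hm : m (Set.Iic 0) = 0) (r : ℝ) :
    mShift m (-r) (Set.Ioi 0) = mShift m r (Set.Ioi 0) := by
  rw [mShift_apply_Ioi_zero hm, mShift_apply_Ioi_zero hm, ← map_mShift,
    Measure.map_apply (by fun_prop) MeasurableSet.univ, Set.preimage_univ]

lemma isFiniteMeasure_mShift {m : Measure ℝ} (hm : m (Set.Iic 0) = 0) {r : ℝ}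
    (hr : m (Set.Ioi r) < ⊤) : IsFiniteMeasure (mShift m r) := by
  refine ⟨?_⟩
  have hs : ∀ s, mShift m r s ≤ m.map (fun z => z + r) s := by
    intro s
    rw [mShift, Measure.smul_apply, smul_eq_mul]
    calc (2⁻¹ : ENNReal) * (m ⊓ m.map fun z => z + r) s ≤ 1 * m.map (fun z => z + r) s := by
          gcongr
          · simp
          · exact inf_le_right
      _ = _ := one_mul _
  have h0 : mShift m r (Set.Iic r) = 0 := by
    refine le_antisymm ((hs _).trans ?_) zero_le
    rw [Measure.map_apply (by fun_prop) measurableSet_Iic]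
    simp [hm]
  calc mShift m r Set.univ = mShift m r (Set.Iic r ∪ Set.Ioi r) := by rw [Set.Iic_union_Ioi]
    _ ≤ mShift m r (Set.Iic r) + mShift m r (Set.Ioi r) := measure_union_le _ _
    _ ≤ 0 + m (Set.Ioi r) := add_le_add h0.le (mShift_le m r _)
    _ < ⊤ := by rwa [zero_add]

lemma isFiniteMeasure_mShift_neg {m : Measure ℝ} (hm : m (Set.Iic 0) = 0) {r : ℝ}
    (hr : m (Set.Ioi r) < ⊤) : IsFiniteMeasure (mShift m (-r)) := by
  have := isFiniteMeasure_mShift hm hr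
  rw [← map_mShift]
  infer_instance

lemma measure_Ioi_lt_top {m : Measure ℝ} {w : ℝ → ℝ} {r δ : ℝ} (hδ : 0 < δ)
    (hw : ∀ z, r < z → δ ≤ w z) (hm : ∫⁻ z, ENNReal.ofReal (w z) ∂m < ⊤) :
    m (Set.Ioi r) < ⊤ := by
  have h : ENNReal.ofReal δ * m (Set.Ioi r) ≤ ∫⁻ z, ENNReal.ofReal (w z) ∂m := by
    rw [← lintegral_indicator_const measurableSet_Ioi]
    refine lintegral_mono fun z => ?_
    by_cases hz : r < z
    · simpa [hz] using ENNReal.ofReal_le_ofReal (hw z hz)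
    · simp [hz]
  exact ENNReal.lt_top_of_mul_ne_top_right (h.trans_lt hm).ne (by simpa using hδ)

lemma integrableOn_Ioi_of_abs_le {m : Measure ℝ} {w f : ℝ → ℝ} (hw : Measurable w)
    (hm : ∫⁻ z, ENNReal.ofReal (w z) ∂m < ⊤) (hf : Measurable f) (K : ℝ)
    (hK : ∀ z, 0 < z → |f z| ≤ K * w z) (hw0 : ∀ z, 0 < z → 0 ≤ w z) :
    IntegrableOn f (Set.Ioi 0) m := by
  have hwi : IntegrableOn w (Set.Ioi 0) m := by
    refine ⟨hw.aestronglyMeasurable, ?_⟩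
    rw [hasFiniteIntegral_iff_ofReal
      ((ae_restrict_iff' measurableSet_Ioi).2 (Filter.Eventually.of_forall hw0))]
    exact (setLIntegral_le_lintegral _ _).trans_lt hm
  refine (hwi.const_mul K).mono' hf.aestronglyMeasurable ?_
  exact (ae_restrict_iff' measurableSet_Ioi).2 (Filter.Eventually.of_forall hK)

lemma measurable_cutoff : Measurable cutoff :=
  Measurable.ite measurableSet_Iic measurable_id measurable_const

lemma continuous_phi0 {x0 : ℝ} (hx0 : 0 < x0) (θ : ℝ) : Continuous (phi0 x0 θ) :=
  continuous_iff_continuousAt.2 fun x => (hasDerivAt_phi0 hx0 θ x).continuousAt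

lemma le_phi0 {x0 : ℝ} (hx0 : 0 < x0) (θ x : ℝ) : θ ≤ phi0 x0 θ x := by
  rw [phi0_eq hx0]
  have : 0 ≤ max (1 - x / x0) 0 ^ 3 := by positivity
  linarith

lemma max_one_sub_div_le_one {x0 x : ℝ} (hx0 : 0 < x0) (hx : 0 ≤ x) :
    max (1 - x / x0) 0 ≤ 1 :=
  max_le (sub_le_self _ (div_nonneg hx hx0.le)) zero_le_one

lemma phi0_le {x0 x : ℝ} (hx0 : 0 < x0) (θ : ℝ) (hx : 0 ≤ x) : phi0 x0 θ x ≤ θ + 1 := by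
  rw [phi0_eq hx0]
  have : max (1 - x / x0) 0 ^ 3 ≤ 1 :=
    pow_le_one₀ (le_max_right _ _) (max_one_sub_div_le_one hx0 hx)
  linarith

lemma phi0_of_le {x0 x : ℝ} (θ : ℝ) (hx : x0 ≤ x) : phi0 x0 θ x = θ :=
  if_neg (not_lt.2 hx)

lemma max_one_sub_div_of_le {x0 x : ℝ} (hx0 : 0 < x0) (hx : x0 ≤ x) :
    max (1 - x / x0) 0 = 0 := by
  rw [max_eq_right]
  rw [sub_nonpos, one_le_div hx0]
  exact hx

lemma deriv_phi0_of_le {x0 x : ℝ} (hx0 : 0 < x0) (θ : ℝ) (hx : x0 ≤ x) :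
    deriv (phi0 x0 θ) x = 0 := by
  rw [(hasDerivAt_phi0 hx0 θ x).deriv, max_one_sub_div_of_le hx0 hx]
  simp

lemma deriv_phi0_nonpos {x0 : ℝ} (hx0 : 0 < x0) (θ x : ℝ) : deriv (phi0 x0 θ) x ≤ 0 := by
  rw [(hasDerivAt_phi0 hx0 θ x).deriv, neg_mul]
  exact neg_nonpos.2 (by positivity)

lemma max_one_sub_div_add {x0 z : ℝ} (hx0 : 0 < x0) (hz : 0 ≤ z) (x : ℝ) :
    max (1 - (x + z) / x0) 0 = max (max (1 - x / x0) 0 - z / x0) 0 := by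
  have hs : 0 ≤ z / x0 := div_nonneg hz hx0.le
  rw [add_div]
  rcases le_total (1 - x / x0) 0 with h | h
  · rw [max_eq_right h, max_eq_right (by linarith), max_eq_right (by linarith)]
  · rw [max_eq_left h]
    congr 1
    ring

lemma phi0_antitone {x0 : ℝ} (hx0 : 0 < x0) (θ : ℝ) : Antitone (phi0 x0 θ) :=
  antitone_of_deriv_nonpos (fun x => (hasDerivAt_phi0 hx0 θ x).differentiableAt)
    (deriv_phi0_nonpos hx0 θ)

lemma phi0_sub_phi0_add_le {x0 x z : ℝ} (hx0 : 0 < x0) (θ : ℝ) (hx : 0 ≤ x) (hz : 0 ≤ z) :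
    phi0 x0 θ x - phi0 x0 θ (x + z) ≤ 3 / x0 * z := by
  have hs : 0 ≤ z / x0 := div_nonneg hz hx0.le
  rw [phi0_eq hx0, phi0_eq hx0, max_one_sub_div_add hx0 hz]
  have hu0 : 0 ≤ max (1 - x / x0) 0 := le_max_right _ _
  have hu1 := max_one_sub_div_le_one hx0 hx
  have he : 3 / x0 * z = 3 * (z / x0) := by ring
  rw [he]
  generalize max (1 - x / x0) 0 = u at *
  generalize z / x0 = s at *
  rcases le_total s u with h | h
  · rw [max_eq_left (sub_nonneg.2 h)]
    nlinarith [mul_nonneg hs hs, mul_nonneg hu0 hs, mul_nonneg (sub_nonneg.2 h) hs,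
      mul_nonneg (mul_nonneg (sub_nonneg.2 h) hs) hs, mul_nonneg hs (mul_nonneg hu0 (sub_nonneg.2 hu1))]
  · rw [max_eq_right (sub_nonpos.2 h)]
    nlinarith [pow_le_of_le_one hu0 hu1 (n := 3) (by norm_num)]

lemma phi0_taylor_nonneg {x0 z : ℝ} (hx0 : 0 < x0) (θ x : ℝ) (hz : 0 ≤ z) :
    0 ≤ phi0 x0 θ (x + z) - phi0 x0 θ x - deriv (phi0 x0 θ) x * z := by
  have hs : 0 ≤ z / x0 := div_nonneg hz hx0.le
  rw [(hasDerivAt_phi0 hx0 θ x).deriv, phi0_eq hx0, phi0_eq hx0, max_one_sub_div_add hx0 hz]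
  have hu0 : 0 ≤ max (1 - x / x0) 0 := le_max_right _ _
  generalize max (1 - x / x0) 0 = u at *
  have he : -(3 / x0) * u ^ 2 * z = -(3 * u ^ 2 * (z / x0)) := by ring
  rw [he]
  generalize z / x0 = s at *
  rcases le_total s u with h | h
  · rw [max_eq_left (sub_nonneg.2 h)]
    nlinarith [mul_nonneg (sub_nonneg.2 h) (sq_nonneg s), mul_nonneg hu0 (sq_nonneg s)]
  · rw [max_eq_right (sub_nonpos.2 h)]
    nlinarith [mul_nonneg (sub_nonneg.2 h) (sq_nonneg u), pow_nonneg hu0 3]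

lemma phi0_taylor_le {x0 x z : ℝ} (hx0 : 0 < x0) (θ : ℝ) (hx : 0 ≤ x) (hz : 0 ≤ z) :
    phi0 x0 θ (x + z) - phi0 x0 θ x - deriv (phi0 x0 θ) x * z ≤ 3 / x0 ^ 2 * z ^ 2 := by
  have hs : 0 ≤ z / x0 := div_nonneg hz hx0.le
  rw [(hasDerivAt_phi0 hx0 θ x).deriv, phi0_eq hx0, phi0_eq hx0, max_one_sub_div_add hx0 hz]
  have hu0 : 0 ≤ max (1 - x / x0) 0 := le_max_right _ _
  have hu1 := max_one_sub_div_le_one hx0 hx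
  generalize max (1 - x / x0) 0 = u at *
  have he : -(3 / x0) * u ^ 2 * z = -(3 * u ^ 2 * (z / x0)) := by ring
  have he' : 3 / x0 ^ 2 * z ^ 2 = 3 * (z / x0) ^ 2 := by ring
  rw [he, he']
  generalize z / x0 = s at *
  rcases le_total s u with h | h
  · rw [max_eq_left (sub_nonneg.2 h)]
    nlinarith [pow_nonneg hs 3, mul_nonneg (sub_nonneg.2 hu1) (sq_nonneg s)]
  · rw [max_eq_right (sub_nonpos.2 h)]
    nlinarith [mul_nonneg (mul_nonneg hu0 hs) (sub_nonneg.2 hu1), mul_nonneg hs (sub_nonneg.2 h),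
      pow_nonneg hu0 3]

lemma exp_neg_le_one_sub_add_sq {t : ℝ} (ht : 0 ≤ t) : Real.exp (-t) ≤ 1 - t + t ^ 2 := by
  have h1 : Real.exp (-t) * Real.exp t = 1 := by rw [← Real.exp_add]; simp
  have h2 := Real.add_one_le_exp t
  have h3 := Real.exp_pos (-t)
  nlinarith [mul_nonneg h3.le (sub_nonneg.2 h2), pow_nonneg ht 3, sq_nonneg (t - 1)]

lemma integrableOn_Ioi_of_sq_bound {μ : Measure ℝ}
    (hμ : ∫⁻ z, ENNReal.ofReal (min 1 (z ^ 2)) ∂μ < ⊤) {f : ℝ → ℝ} (hf : Measurable f) (K : ℝ)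
    (hsmall : ∀ z, 0 < z → z ≤ 1 → |f z| ≤ K * z ^ 2) (hlarge : ∀ z, 1 < z → |f z| ≤ K) :
    IntegrableOn f (Set.Ioi 0) μ := by
  refine integrableOn_Ioi_of_abs_le (by fun_prop) hμ hf K (fun z hz => ?_) fun z _ => by positivity
  rcases le_or_gt z 1 with h | h
  · rw [min_eq_right (pow_le_one₀ hz.le h)]
    exact hsmall z hz h
  · rw [min_eq_left (one_le_pow₀ h.le), mul_one]
    exact hlarge z h

lemma integrableOn_exp_compensated {μ : Measure ℝ}
    (hμ : ∫⁻ z, ENNReal.ofReal (min 1 (z ^ 2)) ∂μ < ⊤) {lam0 : ℝ} (hlam0 : 0 < lam0) :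
    IntegrableOn (fun z => Real.exp (-(lam0 * z)) - 1 + lam0 * cutoff z) (Set.Ioi 0) μ := by
  have hcut := measurable_cutoff
  refine integrableOn_Ioi_of_sq_bound hμ (by fun_prop) (lam0 ^ 2 + 1) (fun z hz h => ?_)
    fun z h => ?_
  · have h1 := exp_neg_le_one_sub_add_sq (mul_nonneg hlam0.le hz.le)
    have h2 := Real.add_one_le_exp (-(lam0 * z))
    rw [cutoff, if_pos h, abs_le]
    constructor <;> nlinarith [sq_nonneg z, sq_nonneg (lam0 * z)]
  · have h1 := Real.exp_pos (-(lam0 * z))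
    have h2 : Real.exp (-(lam0 * z)) ≤ 1 := Real.exp_le_one_iff.2 (by nlinarith)
    rw [cutoff, if_neg (not_le.2 h), abs_le]
    constructor <;> nlinarith [sq_nonneg lam0]

lemma integrableOn_phi0_compensated {μ : Measure ℝ}
    (hμ : ∫⁻ z, ENNReal.ofReal (min 1 (z ^ 2)) ∂μ < ⊤) {x0 x : ℝ} (hx0 : 0 < x0) (θ : ℝ)
    (hx : 0 ≤ x) :
    IntegrableOn (fun z => phi0 x0 θ (x + z) - phi0 x0 θ x - deriv (phi0 x0 θ) x * cutoff z)
      (Set.Ioi 0) μ := by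
  have hcut := measurable_cutoff
  have hφ := (continuous_phi0 hx0 θ).measurable
  have hK : 0 ≤ 3 / x0 ^ 2 := by positivity
  refine integrableOn_Ioi_of_sq_bound hμ (by fun_prop) (3 / x0 ^ 2 + 1) (fun z hz h => ?_)
    fun z h => ?_
  · have h1 := phi0_taylor_nonneg hx0 θ x hz.le
    have h2 := phi0_taylor_le hx0 θ hx hz.le
    rw [cutoff, if_pos h, abs_of_nonneg h1]
    nlinarith [sq_nonneg z]
  · have h1 := le_phi0 hx0 θ (x + z)
    have h2 := phi0_le hx0 θ hx
    have h3 := phi0_antitone hx0 θ (show x ≤ x + z by linarith)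
    rw [cutoff, if_neg (not_le.2 h), abs_le]
    constructor <;> linarith

lemma integrableOn_phi0_mul_exp {μ : Measure ℝ}
    (hμ : ∫⁻ z, ENNReal.ofReal (min 1 (z ^ 2)) ∂μ < ⊤) {x0 x lam0 : ℝ} (hx0 : 0 < x0) (θ : ℝ)
    (hx : 0 ≤ x) (hlam0 : 0 < lam0) :
    IntegrableOn (fun z => (phi0 x0 θ (x + z) - phi0 x0 θ x) * (1 - Real.exp (-(lam0 * z))))
      (Set.Ioi 0) μ := by
  have hφ := (continuous_phi0 hx0 θ).measurable
  have hK : 0 ≤ 3 / x0 := by positivity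
  refine integrableOn_Ioi_of_sq_bound hμ (by fun_prop) (3 / x0 * lam0 + 1) (fun z hz h => ?_)
    fun z h => ?_
  · have h1 := phi0_sub_phi0_add_le hx0 θ hx hz.le
    have h2 := Real.add_one_le_exp (-(lam0 * z))
    have h3 := phi0_antitone hx0 θ (show x ≤ x + z by linarith)
    have h4 : Real.exp (-(lam0 * z)) ≤ 1 := Real.exp_le_one_iff.2 (by nlinarith)
    rw [abs_mul, abs_of_nonpos (by linarith), abs_of_nonneg (by linarith)]
    calc _ ≤ (3 / x0 * z) * (lam0 * z) := by
          apply mul_le_mul <;> nlinarith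
      _ ≤ _ := by nlinarith [sq_nonneg z]
  · have h1 := le_phi0 hx0 θ (x + z)
    have h2 := phi0_le hx0 θ hx
    have h3 := phi0_antitone hx0 θ (show x ≤ x + z by linarith)
    have h4 : Real.exp (-(lam0 * z)) ≤ 1 := Real.exp_le_one_iff.2 (by nlinarith)
    have h5 := Real.exp_pos (-(lam0 * z))
    rw [abs_mul, abs_of_nonpos (by linarith), abs_of_nonneg (by linarith)]
    have h6 : 0 ≤ 3 / x0 * lam0 := by positivity
    nlinarith

lemma integrableOn_phi0_sub {ν : Measure ℝ}
    (hν : ∫⁻ z, ENNReal.ofReal (min 1 z) ∂ν < ⊤) {x0 x : ℝ} (hx0 : 0 < x0) (θ : ℝ)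
    (hx : 0 ≤ x) :
    IntegrableOn (fun z => phi0 x0 θ (x + z) - phi0 x0 θ x) (Set.Ioi 0) ν := by
  have hφ := (continuous_phi0 hx0 θ).measurable
  have hK : 0 ≤ 3 / x0 := by positivity
  refine integrableOn_Ioi_of_abs_le (by fun_prop) hν (by fun_prop) (3 / x0 + 1)
    (fun z hz => ?_) fun z hz => le_min zero_le_one hz.le
  have h1 := le_phi0 hx0 θ (x + z)
  have h2 := phi0_le hx0 θ hx
  have h3 := phi0_antitone hx0 θ (show x ≤ x + z by linarith)
  have h4 := phi0_sub_phi0_add_le hx0 θ hx hz.le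
  rw [abs_of_nonpos (by linarith)]
  rcases le_total z 1 with h | h
  · rw [min_eq_right h]
    linarith
  · rw [min_eq_left h]
    linarith

lemma integral_phi0_compensated_le {μ : Measure ℝ}
    (hμ : ∫⁻ z, ENNReal.ofReal (min 1 (z ^ 2)) ∂μ < ⊤) {x0 x : ℝ} (hx0 : 0 < x0) (θ : ℝ)
    (hx : 0 ≤ x) :
    ∫ z in Set.Ioi (0 : ℝ), (phi0 x0 θ (x + z) - phi0 x0 θ x - deriv (phi0 x0 θ) x * cutoff z) ∂μ
      ≤ 3 / x0 ^ 2 * (∫ z in Set.Ioc (0 : ℝ) 1, z ^ 2 ∂μ) * (if x ≤ x0 then 1 else 0) := by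
  split_ifs with hxx
  · have hi : IntegrableOn ((Set.Iic (1 : ℝ)).indicator fun z => 3 / x0 ^ 2 * z ^ 2)
        (Set.Ioi 0) μ := by
      refine integrableOn_Ioi_of_sq_bound hμ (Measurable.indicator (by fun_prop) measurableSet_Iic)
        (3 / x0 ^ 2) (fun z hz h => ?_) fun z h => ?_
      · rw [Set.indicator_of_mem (Set.mem_Iic.2 h), abs_of_nonneg (by positivity)]
      · rw [Set.indicator_of_notMem (by simpa using h), abs_zero]
        positivity
    calc _ ≤ ∫ z in Set.Ioi (0 : ℝ), (Set.Iic (1 : ℝ)).indicator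
          (fun z => 3 / x0 ^ 2 * z ^ 2) z ∂μ := by
          refine setIntegral_mono_on (integrableOn_phi0_compensated hμ hx0 θ hx) hi
            measurableSet_Ioi fun z hz => ?_
          have hz : 0 < z := hz
          rcases le_or_gt z 1 with h | h
          · rw [Set.indicator_of_mem (Set.mem_Iic.2 h), cutoff, if_pos h]
            exact phi0_taylor_le hx0 θ hx hz.le
          · rw [Set.indicator_of_notMem (by simpa using h), cutoff, if_neg (not_le.2 h)]
            have h3 := phi0_antitone hx0 θ (show x ≤ x + z by linarith)
            linarith
      _ = _ := by
          rw [setIntegral_indicator measurableSet_Iic, Set.Ioi_inter_Iic, integral_const_mul,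
            mul_one]
  · rw [mul_zero]
    refine setIntegral_nonpos measurableSet_Ioi fun z hz => ?_
    have hz : 0 < z := hz
    have h1 : x0 ≤ x := (not_le.1 hxx).le
    rw [phi0_of_le θ h1, phi0_of_le θ (h1.trans (by linarith)), deriv_phi0_of_le hx0 θ h1]
    simp

lemma integrableOn_phi0_add {m : Measure ℝ} [IsFiniteMeasure m] {x0 x : ℝ} (hx0 : 0 < x0)
    {θ : ℝ} (hθ : 0 ≤ θ) (hx : 0 ≤ x) :
    IntegrableOn (fun z => phi0 x0 θ (x + z)) (Set.Ioi 0) m := by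
  have hφ := (continuous_phi0 hx0 θ).measurable
  refine Integrable.of_bound (C := θ + 1)
    (Measurable.aestronglyMeasurable (by fun_prop)) ?_
  refine (ae_restrict_iff' measurableSet_Ioi).2 (Filter.Eventually.of_forall fun z hz => ?_)
  have hz : 0 < z := hz
  rw [Real.norm_eq_abs, abs_of_nonneg (hθ.trans (le_phi0 hx0 θ _))]
  exact phi0_le hx0 θ (by linarith)

lemma setIntegral_F0_separate_le {m : Measure ℝ} [IsFiniteMeasure m] {lam0 x0 θ x y C : ℝ}
    (hlam0 : 0 < lam0) (hx0 : 0 < x0) (hθ : 0 ≤ θ) (hx : 0 ≤ x) (hxy : y < x)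
    (hC : ∀ z, 0 < z → phi0 x0 θ (x + z) ≤ C) :
    ∫ z in Set.Ioi (0 : ℝ), (F0 lam0 x0 θ (x + z) (2 * y + z - x)
        - F0 lam0 x0 θ (x + z) (y + z)) ∂m
      ≤ C * (Real.exp (-(lam0 * (x - y))) - Real.exp (-(lam0 * (x - y))) ^ 2)
        * (m (Set.Ioi 0)).toReal := by
  have hE1 : Real.exp (-(lam0 * (x - y))) ≤ 1 := Real.exp_le_one_iff.2 (by nlinarith)
  have hE0 := Real.exp_pos (-(lam0 * (x - y)))
  have he : ∀ z, F0 lam0 x0 θ (x + z) (2 * y + z - x) - F0 lam0 x0 θ (x + z) (y + z)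
      = phi0 x0 θ (x + z)
        * (Real.exp (-(lam0 * (x - y))) - Real.exp (-(lam0 * (x - y))) ^ 2) := by
    intro z
    rw [F0_of_ne _ _ _ (by intro h; linarith), F0_of_ne _ _ _ (by intro h; linarith), psi0, psi0,
      ← Real.exp_nat_mul]
    have h1 : -(lam0 * (x + z - (2 * y + z - x))) = ((2 : ℕ) : ℝ) * -(lam0 * (x - y)) := by
      push_cast
      ring
    have h2 : x + z - (y + z) = x - y := by ring
    rw [h1, h2]
    ring
  simp_rw [he]
  calc _ ≤ ∫ _ in Set.Ioi (0 : ℝ),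
        C * (Real.exp (-(lam0 * (x - y))) - Real.exp (-(lam0 * (x - y))) ^ 2) ∂m := by
        refine setIntegral_mono_on ((integrableOn_phi0_add hx0 hθ hx).mul_const _)
          (integrable_const _) measurableSet_Ioi fun z hz => ?_
        exact mul_le_mul_of_nonneg_right (hC z hz) (by nlinarith)
    _ = _ := by
        rw [setIntegral_const, smul_eq_mul, mul_comm, Measure.real]

lemma setIntegral_F0_coalesce (m : Measure ℝ) (lam0 x0 θ : ℝ) {x y : ℝ} (hxy : y < x) :
    ∫ z in Set.Ioi (0 : ℝ), (F0 lam0 x0 θ (x + z) (x + z) - F0 lam0 x0 θ (x + z) (y + z)) ∂m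
      = -((2 - Real.exp (-(lam0 * (x - y)))) * ∫ z in Set.Ioi (0 : ℝ), phi0 x0 θ (x + z) ∂m) := by
  rw [← integral_const_mul, ← integral_neg]
  refine integral_congr_ae (Filter.Eventually.of_forall fun z => ?_)
  have h2 : x + z - (y + z) = x - y := by ring
  simp only
  rw [F0_of_ne _ _ _ (show x + z ≠ y + z by intro h; linarith), F0, if_pos rfl, psi0, h2]
  ring

lemma mul_measure_Ioi_le_setIntegral_phi0 {m : Measure ℝ} [IsFiniteMeasure m] {x0 θ x : ℝ}
    (hx0 : 0 < x0) (hθ : 0 ≤ θ) (hx : 0 ≤ x) :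
    θ * (m (Set.Ioi 0)).toReal ≤ ∫ z in Set.Ioi (0 : ℝ), phi0 x0 θ (x + z) ∂m := by
  calc θ * (m (Set.Ioi 0)).toReal = ∫ _ in Set.Ioi (0 : ℝ), θ ∂m := by
        rw [setIntegral_const, smul_eq_mul, mul_comm, Measure.real]
    _ ≤ _ := setIntegral_mono_on (integrable_const _) (integrableOn_phi0_add hx0 hθ hx)
        measurableSet_Ioi fun z _ => le_phi0 hx0 θ _

/-- The contribution of the coupled jumps of the branching measure to `L̃₁ F₀`. -/
lemma branching_coupling_le {m : Measure ℝ} (hm : m (Set.Iic 0) = 0) {lam0 x0 θ x y : ℝ}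
    (hfin : m (Set.Ioi (x - y)) < ⊤)
    (hlam0 : 0 < lam0) (hx0 : 0 < x0) (hθ : 0 ≤ θ) (hx : 0 ≤ x) (hxy : y < x) :
    (∫ z in Set.Ioi (0 : ℝ), (F0 lam0 x0 θ (x + z) (2 * y + z - x)
        - F0 lam0 x0 θ (x + z) (y + z)) ∂(mShift m (x - y)))
      + (∫ z in Set.Ioi (0 : ℝ), (F0 lam0 x0 θ (x + z) (x + z)
        - F0 lam0 x0 θ (x + z) (y + z)) ∂(mShift m (y - x)))
      ≤ -(θ * (mShift m (x - y) (Set.Ioi 0)).toReal)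
        + (mShift m (x - y) (Set.Ioi 0)).toReal * (1 + psi0 lam0 (x - y))
          * (if x ≤ x0 then 1 else 0) := by
  have hneg : y - x = -(x - y) := by ring
  rw [hneg]
  have := isFiniteMeasure_mShift hm hfin
  have := isFiniteMeasure_mShift_neg hm hfin
  have hmass := mShift_neg_apply_Ioi_zero hm (x - y)
  have hE1 : Real.exp (-(lam0 * (x - y))) ≤ 1 := Real.exp_le_one_iff.2 (by nlinarith)
  have hE0 := Real.exp_pos (-(lam0 * (x - y)))
  have h1 := setIntegral_F0_separate_le (m := mShift m (x - y)) (C := θ + if x ≤ x0 then 1 else 0)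
    hlam0 hx0 hθ hx hxy (by
      intro z hz
      split_ifs with h
      · exact phi0_le hx0 θ (by linarith)
      · rw [phi0_of_le θ (by linarith), add_zero])
  have h2 := setIntegral_F0_coalesce (mShift m (-(x - y))) lam0 x0 θ hxy
  have h3 := mul_measure_Ioi_le_setIntegral_phi0 (m := mShift m (-(x - y))) hx0 hθ hx
  rw [hmass] at h3
  rw [h2, psi0]
  have hM : 0 ≤ (mShift m (x - y) (Set.Ioi 0)).toReal := ENNReal.toReal_nonneg
  generalize (mShift m (x - y) (Set.Ioi 0)).toReal = M at *
  generalize Real.exp (-(lam0 * (x - y))) = E at *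
  have hi : (0 : ℝ) ≤ if x ≤ x0 then 1 else 0 := by split_ifs <;> norm_num
  generalize (if x ≤ x0 then (1 : ℝ) else 0) = i at *
  have h4 := mul_le_mul_of_nonneg_left h3 (show 0 ≤ 2 - E by linarith)
  nlinarith [mul_nonneg (mul_nonneg hθ hM) (sq_nonneg (1 - E)),
    mul_nonneg (mul_nonneg hi hM) (show 0 ≤ 2 - E - (E - E ^ 2) by nlinarith)]

lemma setIntegral_F0_diagonal (m : Measure ℝ) (lam0 x0 θ : ℝ) {x y : ℝ} (hxy : y < x) :
    ∫ z in Set.Ioi (0 : ℝ), (F0 lam0 x0 θ (x + z) (y + z) - F0 lam0 x0 θ x y) ∂m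
      = (1 + psi0 lam0 (x - y))
        * ∫ z in Set.Ioi (0 : ℝ), (phi0 x0 θ (x + z) - phi0 x0 θ x) ∂m := by
  rw [← integral_const_mul]
  refine integral_congr_ae (Filter.Eventually.of_forall fun z => ?_)
  have h2 : x + z - (y + z) = x - y := by ring
  simp only
  rw [F0_of_ne _ _ _ (show x + z ≠ y + z by intro h; linarith), F0_of_ne _ _ _ hxy.ne', h2]
  ring

/-- The contribution of the immigration measure to `L̃ F₀`. -/
lemma immigration_coupling_le {m : Measure ℝ} (hm : m (Set.Iic 0) = 0)
    (hloc : ∫⁻ z, ENNReal.ofReal (min 1 z) ∂m < ⊤) {lam0 x0 θ x y : ℝ}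
    (hfin : m (Set.Ioi (x - y)) < ⊤)
    (hlam0 : 0 < lam0) (hx0 : 0 < x0) (hθ : 0 ≤ θ) (hx : 0 ≤ x) (hxy : y < x) :
    (∫ z in Set.Ioi (0 : ℝ), (F0 lam0 x0 θ (x + z) (y + z) - F0 lam0 x0 θ x y) ∂m)
      + (∫ z in Set.Ioi (0 : ℝ), (F0 lam0 x0 θ (x + z) (2 * y + z - x)
        - F0 lam0 x0 θ (x + z) (y + z)) ∂(mShift m (x - y)))
      + (∫ z in Set.Ioi (0 : ℝ), (F0 lam0 x0 θ (x + z) (x + z)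
        - F0 lam0 x0 θ (x + z) (y + z)) ∂(mShift m (y - x)))
      ≤ -(θ * (mShift m (x - y) (Set.Ioi 0)).toReal)
        + (1 + psi0 lam0 (x - y))
          * (∫ z in Set.Ioi (0 : ℝ),
              (phi0 x0 θ (x + z) - phi0 x0 θ x) ∂(m - mShift m (y - x)))
          * (if x ≤ x0 then 1 else 0) := by
  have hneg : y - x = -(x - y) := by ring
  rw [hneg, setIntegral_F0_diagonal m lam0 x0 θ hxy]
  have := isFiniteMeasure_mShift hm hfin
  have := isFiniteMeasure_mShift_neg hm hfin
  have hmass := mShift_neg_apply_Ioi_zero hm (x - y)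
  have hE1 : Real.exp (-(lam0 * (x - y))) ≤ 1 := Real.exp_le_one_iff.2 (by nlinarith)
  have hE0 := Real.exp_pos (-(lam0 * (x - y)))
  have h1 := setIntegral_F0_separate_le (m := mShift m (x - y)) (C := phi0 x0 θ x)
    hlam0 hx0 hθ hx hxy fun z hz => phi0_antitone hx0 θ (by linarith)
  have h2 := setIntegral_F0_coalesce (mShift m (-(x - y))) lam0 x0 θ hxy
  have hint := integrableOn_phi0_sub hloc hx0 θ hx
  have hint1 : IntegrableOn (fun z => phi0 x0 θ (x + z) - phi0 x0 θ x) (Set.Ioi 0)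
      (m - mShift m (-(x - y))) := hint.mono_measure Measure.sub_le
  have hint2 : IntegrableOn (fun z => phi0 x0 θ (x + z) - phi0 x0 θ x) (Set.Ioi 0)
      (mShift m (-(x - y))) := hint.mono_measure (mShift_le _ _)
  have hsplit : ∫ z in Set.Ioi (0 : ℝ), (phi0 x0 θ (x + z) - phi0 x0 θ x) ∂m
      = (∫ z in Set.Ioi (0 : ℝ), (phi0 x0 θ (x + z) - phi0 x0 θ x) ∂(m - mShift m (-(x - y))))
        + ∫ z in Set.Ioi (0 : ℝ), (phi0 x0 θ (x + z) - phi0 x0 θ x) ∂(mShift m (-(x - y))) := by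
    rw [← integral_add_measure hint1 hint2, ← Measure.restrict_add,
      Measure.sub_add_cancel_of_le (mShift_le _ _)]
  have hsub : ∫ z in Set.Ioi (0 : ℝ), (phi0 x0 θ (x + z) - phi0 x0 θ x) ∂(mShift m (-(x - y)))
      = (∫ z in Set.Ioi (0 : ℝ), phi0 x0 θ (x + z) ∂(mShift m (-(x - y))))
        - phi0 x0 θ x * (mShift m (x - y) (Set.Ioi 0)).toReal := by
    rw [integral_sub (integrableOn_phi0_add hx0 hθ hx) (integrable_const _), setIntegral_const,
      Measure.real, hmass, smul_eq_mul, mul_comm]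
  have hind : (∫ z in Set.Ioi (0 : ℝ),
        (phi0 x0 θ (x + z) - phi0 x0 θ x) ∂(m - mShift m (-(x - y))))
      = (∫ z in Set.Ioi (0 : ℝ),
        (phi0 x0 θ (x + z) - phi0 x0 θ x) ∂(m - mShift m (-(x - y))))
        * (if x ≤ x0 then 1 else 0) := by
    split_ifs with h
    · rw [mul_one]
    · rw [mul_zero]
      refine setIntegral_eq_zero_of_forall_eq_zero fun z hz => ?_
      have hz : 0 < z := hz
      rw [phi0_of_le θ (by linarith), phi0_of_le θ (by linarith), sub_self]
  rw [mul_assoc (1 + psi0 lam0 (x - y)), ← hind, h2, hsplit, hsub, psi0]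
  have hφ := le_phi0 hx0 θ x
  have hM : 0 ≤ (mShift m (x - y) (Set.Ioi 0)).toReal := ENNReal.toReal_nonneg
  generalize (mShift m (x - y) (Set.Ioi 0)).toReal = M at *
  generalize Real.exp (-(lam0 * (x - y))) = E at *
  nlinarith [mul_nonneg (mul_nonneg (hθ.trans hφ) hM) (sq_nonneg (1 - E)),
    mul_nonneg hM (sub_nonneg.2 hφ)]

/-- Jumps of the branching measure which move only the larger component. -/
lemma setIntegral_F0_left_le {μ : Measure ℝ}
    (hμ : ∫⁻ z, ENNReal.ofReal (min 1 (z ^ 2)) ∂μ < ⊤) {lam0 x0 θ x y : ℝ}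
    (hlam0 : 0 < lam0) (hx0 : 0 < x0) (hx : 0 ≤ x) (hxy : y < x) :
    ∫ z in Set.Ioi (0 : ℝ), (F0 lam0 x0 θ (x + z) y - F0 lam0 x0 θ x y
        - Fx (F0 lam0 x0 θ) x y * cutoff z) ∂μ
      ≤ -(phi0 x0 θ x * Real.exp (-(lam0 * (x - y)))
          * ∫ z in Set.Ioi (0 : ℝ), (Real.exp (-(lam0 * z)) - 1 + lam0 * cutoff z) ∂μ)
        + (1 + psi0 lam0 (x - y)) * ∫ z in Set.Ioi (0 : ℝ),
            (phi0 x0 θ (x + z) - phi0 x0 θ x - deriv (phi0 x0 θ) x * cutoff z) ∂μ := by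
  have i1 := (integrableOn_exp_compensated hμ hlam0).const_mul
    (-(phi0 x0 θ x * Real.exp (-(lam0 * (x - y)))))
  have i2 := (integrableOn_phi0_compensated hμ hx0 θ hx).const_mul (1 + psi0 lam0 (x - y))
  have i3 := (integrableOn_phi0_mul_exp hμ hx0 θ hx hlam0).const_mul
    (Real.exp (-(lam0 * (x - y))))
  have he : ∀ z ∈ Set.Ioi (0 : ℝ), F0 lam0 x0 θ (x + z) y - F0 lam0 x0 θ x y
        - Fx (F0 lam0 x0 θ) x y * cutoff z
      = -(phi0 x0 θ x * Real.exp (-(lam0 * (x - y))))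
          * (Real.exp (-(lam0 * z)) - 1 + lam0 * cutoff z)
        + (1 + psi0 lam0 (x - y))
          * (phi0 x0 θ (x + z) - phi0 x0 θ x - deriv (phi0 x0 θ) x * cutoff z)
        + Real.exp (-(lam0 * (x - y)))
          * ((phi0 x0 θ (x + z) - phi0 x0 θ x) * (1 - Real.exp (-(lam0 * z)))) := by
    intro z hz
    have hz : 0 < z := hz
    have hexp : Real.exp (-(lam0 * (x + z - y)))
        = Real.exp (-(lam0 * (x - y))) * Real.exp (-(lam0 * z)) := by
      rw [← Real.exp_add]
      ring_nf
    rw [F0_of_ne _ _ _ (show x + z ≠ y by intro h; linarith), F0_of_ne _ _ _ hxy.ne',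
      Fx_F0 lam0 θ hx0 hxy.ne', psi0, psi0, hexp]
    ring
  have h3 : ∫ z in Set.Ioi (0 : ℝ), Real.exp (-(lam0 * (x - y)))
      * ((phi0 x0 θ (x + z) - phi0 x0 θ x) * (1 - Real.exp (-(lam0 * z)))) ∂μ ≤ 0 := by
    refine setIntegral_nonpos measurableSet_Ioi fun z hz => ?_
    have hz : 0 < z := hz
    have h1 := phi0_antitone hx0 θ (show x ≤ x + z by linarith)
    have h2 : Real.exp (-(lam0 * z)) ≤ 1 := Real.exp_le_one_iff.2 (by nlinarith)
    exact mul_nonpos_of_nonneg_of_nonpos (Real.exp_pos _).le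
      (mul_nonpos_of_nonpos_of_nonneg (by linarith) (by linarith))
  rw [setIntegral_congr_fun measurableSet_Ioi he, integral_add ?_ i3, integral_add i1 i2,
    integral_const_mul, integral_const_mul]
  · linarith
  · exact i1.add i2

lemma setIntegral_F0_diagonal_compensated (m : Measure ℝ) (lam0 θ : ℝ) {x0 x y : ℝ}
    (hx0 : 0 < x0) (hxy : y < x) :
    ∫ z in Set.Ioi (0 : ℝ), (F0 lam0 x0 θ (x + z) (y + z) - F0 lam0 x0 θ x y
        - (Fx (F0 lam0 x0 θ) x y + Fy (F0 lam0 x0 θ) x y) * cutoff z) ∂m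
      = (1 + psi0 lam0 (x - y)) * ∫ z in Set.Ioi (0 : ℝ),
            (phi0 x0 θ (x + z) - phi0 x0 θ x - deriv (phi0 x0 θ) x * cutoff z) ∂m := by
  rw [← integral_const_mul]
  refine integral_congr_ae (Filter.Eventually.of_forall fun z => ?_)
  have h2 : x + z - (y + z) = x - y := by ring
  simp only
  rw [F0_of_ne _ _ _ (show x + z ≠ y + z by intro h; linarith), F0_of_ne _ _ _ hxy.ne', h2,
    Fx_F0 lam0 θ hx0 hxy.ne', Fy_F0 lam0 θ hxy.ne', psi0]
  ring

/-- The drift and diffusion part of `L̃₀ F₀`. -/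
lemma local_part_le {b c β lam0 x0 θ x y : ℝ} {g : ℝ → ℝ} (hc : 0 ≤ c) (hlam0 : 0 < lam0)
    (hx0 : 0 < x0) (hθ : 0 ≤ θ) (hy : 0 ≤ y) (hxy : y < x) (hg : g y ≤ g x) :
    (β - b * x - g x) * Fx (F0 lam0 x0 θ) x y + (β - b * y - g y) * Fy (F0 lam0 x0 θ) x y
        + c * x * Fxx (F0 lam0 x0 θ) x y + c * y * Fyy (F0 lam0 x0 θ) x y
        - 2 * c * y * Fxy (F0 lam0 x0 θ) x y
      ≤ -(c * lam0 ^ 2 * θ * y * Real.exp (-(lam0 * (x - y))))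
        - phi0 x0 θ x * Real.exp (-(lam0 * (x - y))) * (x - y) * (b * lam0 + c * lam0 ^ 2)
        + ((β - b * x - g x) * deriv (phi0 x0 θ) x + 3 * x / x0 ^ 2 * (2 * c))
          * (1 + psi0 lam0 (x - y)) * (if x ≤ x0 then 1 else 0) := by
  rw [Fx_F0 lam0 θ hx0 hxy.ne', Fy_F0 lam0 θ hxy.ne', Fxx_F0 lam0 θ hx0 hxy.ne',
    Fyy_F0 lam0 θ hxy.ne', Fxy_F0 lam0 θ hx0 hxy.ne', psi0]
  have hx : 0 < x := by linarith
  have hE1 : Real.exp (-(lam0 * (x - y))) ≤ 1 := Real.exp_le_one_iff.2 (by nlinarith)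
  have hE0 := Real.exp_pos (-(lam0 * (x - y)))
  have hφ := le_phi0 hx0 θ x
  have hD := deriv_phi0_nonpos hx0 θ x
  have hI : (β - b * x - g x) * deriv (phi0 x0 θ) x
      = (β - b * x - g x) * deriv (phi0 x0 θ) x * (if x ≤ x0 then 1 else 0) := by
    split_ifs with h
    · rw [mul_one]
    · rw [deriv_phi0_of_le hx0 θ (by linarith)]
      simp
  have hu : 6 / x0 ^ 2 * max (1 - x / x0) 0 ≤ 6 / x0 ^ 2 * (if x ≤ x0 then 1 else 0) := by
    refine mul_le_mul_of_nonneg_left ?_ (by positivity)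
    split_ifs with h
    · exact max_one_sub_div_le_one hx0 hx.le
    · rw [max_one_sub_div_of_le hx0 (by linarith)]
  have hJ : 3 * x / x0 ^ 2 * (2 * c) = c * x * (6 / x0 ^ 2) := by ring
  rw [hJ]
  generalize (if x ≤ x0 then (1 : ℝ) else 0) = i at *
  generalize 6 / x0 ^ 2 * max (1 - x / x0) 0 = U at *
  generalize 6 / x0 ^ 2 = S at *
  generalize Real.exp (-(lam0 * (x - y))) = E at *
  generalize phi0 x0 θ x = P at *
  generalize deriv (phi0 x0 θ) x = D at *
  have hP : 0 ≤ P := hθ.trans hφ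
  have k1 : 0 ≤ P * lam0 * E * (g x - g y) :=
    mul_nonneg (by positivity) (sub_nonneg.2 hg)
  have k2 : 0 ≤ c * (x + y) * lam0 * E * (-D) := mul_nonneg (by positivity) (by linarith)
  have k3 : 0 ≤ c * x * (2 - E) * (S * i - U) :=
    mul_nonneg (mul_nonneg (by positivity) (by linarith)) (sub_nonneg.2 hu)
  have k4 : 0 ≤ c * lam0 ^ 2 * y * E * (P - θ) :=
    mul_nonneg (by positivity) (sub_nonneg.2 hφ)
  have k5 : 0 ≤ c * lam0 ^ 2 * y * E * P := by positivity
  have k6 : ((β - b * x - g x) * D + c * x * S) * (1 + (1 - E)) * i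
      = (β - b * x - g x) * D * (2 - E) + c * x * (2 - E) * (S * i) := by
    linear_combination -(2 - E) * hI
  rw [k6]
  nlinarith

/- Lemma 4.3 of Li–Li–Wang–Zhou: if `Ψ(λ₀) > 0` for the fixed `λ₀ > 0`, then for
any `l ≥ 1` there is `λ₁ > 0` (one may take `λ₁ = λ₀⁻¹ e^{−λ₀ l} Ψ(λ₀)`) such
that on `Δᶜ`,
`L̃F₀(x,y) ≤ −cλ₀²θy e^{−λ₀(x−y)} − θy μ_{x−y}(0,∞) − θ ν_{x−y}(0,∞)
  − λ₁θψ(x−y)1_{x−y≤l} + [y μ_{x−y}(0,∞) + I(x) + J(x)][1+ψ(x−y)]1_{x≤x₀}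
  + [1+ψ(x−y)] (∫₀^∞ [φ(x+z) − φ(x)] (ν−ν_{y−x})(dz)) 1_{x≤x₀}`,
where `I(x) = [β − bx − g(x)]φ′(x)` and `J(x) = (3x/x₀²)(2c + ∫₀^1 z² μ(dz))`. -/
theorem coupling_generator_F0_estimate
    (b c β lam0 x0 θ : ℝ) (hc : 0 ≤ c) (hβ : 0 ≤ β) (hlam0 : 0 < lam0)
    (hx0 : 0 < x0) (hx01 : x0 < 1) (hθ : 4 ≤ θ)
    (μ ν : Measure ℝ)
    (hμsupp : μ (Set.Iic 0) = 0) (hνsupp : ν (Set.Iic 0) = 0)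
    (hμloc : ∫⁻ z, ENNReal.ofReal (min 1 (z ^ 2)) ∂μ < ⊤)
    (hνloc : ∫⁻ z, ENNReal.ofReal (min 1 z) ∂ν < ⊤)
    (g : ℝ → ℝ) (hg0 : g 0 = 0) (hgmono : MonotoneOn g (Set.Ici 0))
    (hgcont : ContinuousOn g (Set.Ici 0)) (hgnonneg : ∀ x ∈ Set.Ici (0 : ℝ), 0 ≤ g x)
    (hPsi : 0 < Psi b c μ lam0) :
    ∀ l : ℝ, 1 ≤ l → ∃ lam1 : ℝ, 0 < lam1 ∧
      lam1 = lam0⁻¹ * Real.exp (-(lam0 * l)) * Psi b c μ lam0 ∧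
      ∀ x y : ℝ, 0 ≤ y → y < x →
        Ltil b c β g μ ν (F0 lam0 x0 θ) x y ≤
          -(c * lam0 ^ 2 * θ * y * Real.exp (-(lam0 * (x - y))))
            - θ * y * ((mShift μ (x - y)) (Set.Ioi 0)).toReal
            - θ * ((mShift ν (x - y)) (Set.Ioi 0)).toReal
            - lam1 * θ * psi0 lam0 (x - y) * (if x - y ≤ l then 1 else 0)
            + (y * ((mShift μ (x - y)) (Set.Ioi 0)).toReal
                + (β - b * x - g x) * deriv (phi0 x0 θ) x
                + (3 * x / x0 ^ 2) * (2 * c + ∫ z in Set.Ioc (0 : ℝ) 1, z ^ 2 ∂μ))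
              * (1 + psi0 lam0 (x - y)) * (if x ≤ x0 then 1 else 0)
            + (1 + psi0 lam0 (x - y))
              * (∫ z in Set.Ioi (0 : ℝ),
                  (phi0 x0 θ (x + z) - phi0 x0 θ x) ∂(ν - mShift ν (y - x)))
              * (if x ≤ x0 then 1 else 0) := by
  intro l _
  refine ⟨_, by positivity, rfl, fun x y hy hxy => ?_⟩
  have hx : 0 ≤ x := by linarith
  have hr : 0 < x - y := by linarith
  have hθ' : 0 ≤ θ := by linarith
  have hμfin : μ (Set.Ioi (x - y)) < ⊤ :=
    measure_Ioi_lt_top (δ := min 1 ((x - y) ^ 2)) (by positivity)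
      (fun z hz => min_le_min_left 1 (pow_le_pow_left₀ hr.le (le_of_lt hz) 2)) hμloc
  have hνfin : ν (Set.Ioi (x - y)) < ⊤ :=
    measure_Ioi_lt_top (δ := min 1 (x - y)) (by positivity)
      (fun z hz => min_le_min_left 1 (le_of_lt hz)) hνloc
  have hloc := local_part_le (b := b) (β := β) hc hlam0 hx0 hθ' hy hxy
    (hgmono (Set.mem_Ici.2 hy) (Set.mem_Ici.2 hx) hxy.le)
  have hleft := mul_le_mul_of_nonneg_left
    (setIntegral_F0_left_le (θ := θ) hμloc hlam0 hx0 hx hxy) hr.le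
  have hdiag := setIntegral_F0_diagonal_compensated μ lam0 θ hx0 hxy
  have hbranch := mul_le_mul_of_nonneg_left
    (branching_coupling_le hμsupp hμfin hlam0 hx0 hθ' hx hxy) hy
  have himm := immigration_coupling_le hνsupp hνloc hνfin hlam0 hx0 hθ' hx hxy
  have hE1 : Real.exp (-(lam0 * (x - y))) ≤ 1 := Real.exp_le_one_iff.2 (by nlinarith)
  have hψ : 0 ≤ 1 + psi0 lam0 (x - y) := by
    rw [psi0]
    linarith
  have hcomp := mul_le_mul_of_nonneg_left (integral_phi0_compensated_le hμloc hx0 θ hx)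
    (mul_nonneg hx hψ)
  have hcontract : lam0⁻¹ * Real.exp (-(lam0 * l)) * Psi b c μ lam0 * θ * psi0 lam0 (x - y)
        * (if x - y ≤ l then 1 else 0)
      ≤ phi0 x0 θ x * Real.exp (-(lam0 * (x - y))) * (x - y) * Psi b c μ lam0 := by
    have hφ := le_phi0 hx0 θ x
    have hφ0 : 0 ≤ phi0 x0 θ x := hθ'.trans hφ
    split_ifs with h
    · have h1 : lam0⁻¹ * psi0 lam0 (x - y) ≤ x - y := by
        rw [inv_mul_le_iff₀ hlam0, psi0]
        linarith [Real.add_one_le_exp (-(lam0 * (x - y)))]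
      have h2 : Real.exp (-(lam0 * l)) ≤ Real.exp (-(lam0 * (x - y))) :=
        Real.exp_le_exp.2 (neg_le_neg (mul_le_mul_of_nonneg_left h hlam0.le))
      calc _ = θ * Real.exp (-(lam0 * l)) * (lam0⁻¹ * psi0 lam0 (x - y)) * Psi b c μ lam0 := by
            ring
        _ ≤ _ := by
            gcongr
            rw [psi0]
            exact mul_nonneg (inv_nonneg.2 hlam0.le) (by linarith)
    · rw [mul_zero]
      positivity
  rw [Psi] at hcontract
  rw [Ltil, Ltil0, Ltil1, hdiag, Psi]
  have hJ : 3 * x / x0 ^ 2 * (2 * c + ∫ z in Set.Ioc (0 : ℝ) 1, z ^ 2 ∂μ)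
      = 3 * x / x0 ^ 2 * (2 * c) + x * (3 / x0 ^ 2 * ∫ z in Set.Ioc (0 : ℝ) 1, z ^ 2 ∂μ) := by
    ring
  rw [hJ]
  linarith
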